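/- Let ω₁, ω₂ be ℝ-linearly independent quaternions with lattice Λ = {w_k : k ∈ ℤ²}, w_k = 2(k₁ω₁ + k₂ω₂), and let ζ₂ be the associated Weierstrass zeta function on ℍ \ Λ. Let ϖ ∈ ℍ be a half-period, i.e. 2ϖ ∈ Λ but ϖ ∉ Λ. Then for every x ∈ ℍ with x ∉ Λ, ζ₂(x + 2ϖ) − ζ₂(x) = 2ζ₂(ϖ). -/

import Mathlib

noncomputable section

/-- The lattice vector `w_k = 2(k₁ω₁ + k₂ω₂)` in the quaternions. -/
def wk (ω : Fin 2 → Quaternion ℝ) (k : Fin 2 → ℤ) : Quaternion ℝ :=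
  2 * ∑ i : Fin 2, (k i : ℝ) • ω i

/-- The Weierstrass zeta function
`ζ₂(x) = x⁻¹ + Σ_{k ≠ 0} [ (x − w_k)⁻¹ + w_k⁻¹ + w_k⁻¹ x w_k⁻¹ ]`. -/
def zeta2 (ω : Fin 2 → Quaternion ℝ) (x : Quaternion ℝ) : Quaternion ℝ :=
  x⁻¹ + ∑' k : {k : Fin 2 → ℤ // k ≠ 0},
    ((x - wk ω k.1)⁻¹ +
      ∑ μ ∈ Finset.range 2, ((wk ω k.1)⁻¹ * x) ^ μ * (wk ω k.1)⁻¹)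

lemma wk_add (ω : Fin 2 → Quaternion ℝ) (k m : Fin 2 → ℤ) :
    wk ω (k + m) = wk ω k + wk ω m := by
  simp only [wk, Fin.sum_univ_two, Pi.add_apply, Int.cast_add, add_smul, mul_add]
  abel

lemma wk_neg (ω : Fin 2 → Quaternion ℝ) (k : Fin 2 → ℤ) : wk ω (-k) = -wk ω k := by
  simp only [wk, Fin.sum_univ_two, Pi.neg_apply, Int.cast_neg, neg_smul, mul_add, mul_neg]
  abel

lemma wk_zero (ω : Fin 2 → Quaternion ℝ) : wk ω 0 = 0 := by
  simp [wk]

lemma exists_norm_le_mul_norm_wk {ω : Fin 2 → Quaternion ℝ} (hω : LinearIndependent ℝ ω) :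
    ∃ C : ℝ, 0 < C ∧ ∀ k : Fin 2 → ℤ, ‖k‖ ≤ C * ‖wk ω k‖ := by
  obtain ⟨K, hK, hanti⟩ := (Fintype.linearCombination ℝ ω).exists_antilipschitzWith
    (LinearMap.ker_eq_bot.2 hω.fintypeLinearCombination_injective)
  refine ⟨K, by exact_mod_cast hK, fun k ↦ ?_⟩
  have h := ZeroHomClass.bound_of_antilipschitz (Fintype.linearCombination ℝ ω) hanti
    (fun i ↦ (k i : ℝ))
  have hk : ‖k‖ = ‖fun i ↦ (k i : ℝ)‖ := by
    simp only [Pi.norm_def, ← Int.norm_cast_real, nnnorm]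
  have hw : ‖wk ω k‖ = 2 * ‖Fintype.linearCombination ℝ ω (fun i ↦ (k i : ℝ))‖ := by
    have h2 : ‖(2 : Quaternion ℝ)‖ = 2 := by
      exact (Quaternion.norm_coe (2 : ℝ)).trans (by norm_num)
    rw [wk, norm_mul, h2, Fintype.linearCombination_apply]
  rw [hk, hw]
  refine h.trans (mul_le_mul_of_nonneg_left ?_ K.2)
  linarith [norm_nonneg (Fintype.linearCombination ℝ ω (fun i ↦ (k i : ℝ)))]

/-- The general term of `ζ₂`. With the convention `0⁻¹ = 0`, the term at `k = 0` is `x⁻¹`. -/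
def zeta2Term (ω : Fin 2 → Quaternion ℝ) (x : Quaternion ℝ) (k : Fin 2 → ℤ) : Quaternion ℝ :=
  (x - wk ω k)⁻¹ + (wk ω k)⁻¹ + (wk ω k)⁻¹ * x * (wk ω k)⁻¹

lemma inv_sub_add_inv_add {D : Type*} [DivisionRing D] {x w : D} (hw : w ≠ 0) (hxw : x - w ≠ 0) :
    (x - w)⁻¹ + w⁻¹ + w⁻¹ * x * w⁻¹ = (x - w)⁻¹ * x * w⁻¹ * x * w⁻¹ := by
  have h : (x - w)⁻¹ + w⁻¹ = (x - w)⁻¹ * x * w⁻¹ := by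
    rw [inv_add_inv' hxw hw, sub_add_cancel]
  rw [← h, add_mul, add_mul, h]

lemma summable_zeta2Term {ω : Fin 2 → Quaternion ℝ} (hω : LinearIndependent ℝ ω)
    (x : Quaternion ℝ) : Summable (zeta2Term ω x) := by
  obtain ⟨C, hC, hCk⟩ := exists_norm_le_mul_norm_wk hω
  have hsum : Summable fun k : Fin 2 → ℤ ↦ 2 * ‖x‖ ^ 2 * C ^ 3 * ‖k‖ ^ (-3 : ℝ) :=
    (EisensteinSeries.summable_one_div_norm_rpow (by norm_num)).mul_left _
  refine hsum.of_norm_bounded_eventually ?_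
  have hlarge : ∀ᶠ k : Fin 2 → ℤ in Filter.cofinite, C * (2 * ‖x‖ + 1) ≤ ‖k‖ := by
    rw [← Filter.cocompact_eq_cofinite]
    exact tendsto_norm_cocompact_atTop.eventually_ge_atTop _
  filter_upwards [hlarge] with k hk
  have hwx : 2 * ‖x‖ + 1 ≤ ‖wk ω k‖ := le_of_mul_le_mul_left (hk.trans (hCk k)) hC
  have hx := norm_nonneg x
  have hwpos : 0 < ‖wk ω k‖ := by linarith
  have hkpos : 0 < ‖k‖ := lt_of_lt_of_le (by positivity) hk
  have hxw : ‖wk ω k‖ / 2 ≤ ‖x - wk ω k‖ := by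
    have := norm_sub_norm_le (wk ω k) x
    rw [norm_sub_rev] at this
    linarith
  have hxwpos : 0 < ‖x - wk ω k‖ := by linarith
  rw [zeta2Term, inv_sub_add_inv_add (norm_pos_iff.1 hwpos) (norm_pos_iff.1 hxwpos)]
  simp only [norm_mul, norm_inv]
  have h1 : ‖x - wk ω k‖⁻¹ ≤ 2 * C * ‖k‖⁻¹ := by
    rw [← div_eq_mul_inv, inv_le_comm₀ hxwpos (by positivity), inv_div, div_le_iff₀ (by positivity)]
    nlinarith [hCk k]
  have h2 : ‖wk ω k‖⁻¹ ≤ C * ‖k‖⁻¹ := by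
    rw [← div_eq_mul_inv, inv_le_comm₀ hwpos (by positivity), inv_div, div_le_iff₀ hC]
    linarith [hCk k]
  calc ‖x - wk ω k‖⁻¹ * ‖x‖ * ‖wk ω k‖⁻¹ * ‖x‖ * ‖wk ω k‖⁻¹
      ≤ (2 * C * ‖k‖⁻¹) * ‖x‖ * (C * ‖k‖⁻¹) * ‖x‖ * (C * ‖k‖⁻¹) := by gcongr
    _ = 2 * ‖x‖ ^ 2 * C ^ 3 * ‖k‖ ^ (-3 : ℝ) := by
      rw [Real.rpow_neg hkpos.le, show (3 : ℝ) = (3 : ℕ) by norm_num, Real.rpow_natCast]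
      ring

lemma zeta2_eq_tsum {ω : Fin 2 → Quaternion ℝ} (hω : LinearIndependent ℝ ω) (x : Quaternion ℝ) :
    zeta2 ω x = ∑' k, zeta2Term ω x k := by
  rw [← (summable_zeta2Term hω x).sum_add_tsum_subtype_compl {0}, Finset.sum_singleton, zeta2]
  congr 1
  · simp [zeta2Term, wk_zero]
  · have hset : {k : Fin 2 → ℤ | k ≠ 0} = {k | k ∉ ({0} : Finset (Fin 2 → ℤ))} := by
      ext; simp
    simp only [Finset.sum_range_succ, Finset.sum_range_zero, pow_zero, pow_one, zero_add, one_mul,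
      ← add_assoc]
    exact tsum_congr_set_coe (zeta2Term ω x) hset

lemma zeta2_neg {ω : Fin 2 → Quaternion ℝ} (hω : LinearIndependent ℝ ω) (x : Quaternion ℝ) :
    zeta2 ω (-x) = -zeta2 ω x := by
  rw [zeta2_eq_tsum hω, zeta2_eq_tsum hω, ← tsum_neg, ← (Equiv.neg (Fin 2 → ℤ)).tsum_eq]
  refine tsum_congr fun k ↦ ?_
  have h : -x - -wk ω k = -(x - wk ω k) := by abel
  simp only [zeta2Term, Equiv.neg_apply, wk_neg, h, inv_neg, mul_neg, neg_mul]
  abel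

/-- The sum of the increments of an even function along a translation vanishes. -/
lemma tsum_add_right_sub_of_even {G E : Type*} [AddCommGroup G] [NormedAddCommGroup E]
    [NormedSpace ℝ E] (f : G → E)
    (hf : ∀ k, f (-k) = f k) (m : G) : ∑' k, (f (k + m) - f k) = 0 := by
  have h : ∑' k, (f (k + m) - f k) = -∑' k, (f (k + m) - f k) := by
    rw [← tsum_neg]
    conv_lhs => rw [← (Equiv.subLeft (-m)).tsum_eq]
    refine tsum_congr fun k ↦ ?_
    have h1 : -m - k + m = -k := by abel
    have h2 : -m - k = -(k + m) := by abel
    rw [Equiv.subLeft_apply, h1, h2, hf, hf, neg_sub]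
  have : IsAddTorsionFree E := .of_isTorsionFree ℝ E
  exact self_eq_neg.1 h

/-- The increment of `ζ₂` along a lattice vector does not depend on the base point. -/
lemma zeta2_add_wk_sub {ω : Fin 2 → Quaternion ℝ} (hω : LinearIndependent ℝ ω) (m : Fin 2 → ℤ)
    (x y : Quaternion ℝ) :
    zeta2 ω (x + wk ω m) - zeta2 ω x = zeta2 ω (y + wk ω m) - zeta2 ω y := by
  have hshift (z : Quaternion ℝ) : Summable fun k ↦ zeta2Term ω (z + wk ω m) (k + m) :=
    (Equiv.addRight m).summable_iff.2 (summable_zeta2Term hω (z + wk ω m))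
  have hzeta (z : Quaternion ℝ) : zeta2 ω (z + wk ω m) - zeta2 ω z =
      ∑' k, (zeta2Term ω (z + wk ω m) (k + m) - zeta2Term ω z k) := by
    rw [(hshift z).tsum_sub (summable_zeta2Term hω z), zeta2_eq_tsum hω, zeta2_eq_tsum hω]
    exact congrArg (· - _) ((Equiv.addRight m).tsum_eq (zeta2Term ω (z + wk ω m))).symm
  rw [← sub_eq_zero, hzeta, hzeta, ← ((hshift x).sub (summable_zeta2Term hω x)).tsum_sub
    ((hshift y).sub (summable_zeta2Term hω y)),
    ← tsum_add_right_sub_of_even (fun k ↦ (wk ω k)⁻¹ * (x - y) * (wk ω k)⁻¹)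
      (fun k ↦ by simp [wk_neg, inv_neg]) m]
  refine tsum_congr fun k ↦ ?_
  have hsub (z : Quaternion ℝ) : z + wk ω m - wk ω (k + m) = z - wk ω k := by
    rw [wk_add]; abel
  simp only [zeta2Term, hsub]
  noncomm_ring

/-- Quasi-periodicity of `ζ₂`: for a half-period `ϖ` (`2ϖ` in the lattice, `ϖ` not)
and `x` off the lattice, `ζ₂(x + 2ϖ) − ζ₂(x) = 2ζ₂(ϖ)`. -/
theorem zeta2_quasiperiodic (ω : Fin 2 → Quaternion ℝ)
    (hω : LinearIndependent ℝ ω) (ϖ : Quaternion ℝ)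
    (hϖ1 : 2 * ϖ ∈ Set.range (wk ω)) (hϖ2 : ϖ ∉ Set.range (wk ω))
    (x : Quaternion ℝ) (hx : x ∉ Set.range (wk ω)) :
    zeta2 ω (x + 2 * ϖ) - zeta2 ω x = 2 * zeta2 ω ϖ := by
  obtain ⟨m, hm⟩ := hϖ1
  rw [← hm, zeta2_add_wk_sub hω m x (-ϖ), hm, zeta2_neg hω]
  have h : -ϖ + 2 * ϖ = ϖ := by rw [two_mul]; abel
  rw [h, sub_neg_eq_add, two_mul]

end
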